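/- For every real β ≥ 1 define K_β(x) = (1/π) ∫_0^1 (1 − u^β) cos(ux) du for x ∈ ℝ. Then K_β is integrable on ℝ, ∫_ℝ K_β(x) dx = 1, and for every λ ∈ ℝ the Fourier transform of K_β satisfies ∫_ℝ e^{iλx} K_β(x) dx = max(1 − |λ|^β, 0). -/

import Mathlib

open MeasureTheory

open scoped FourierTransform

lemma continuous_cosIntegral {β : ℝ} (hβ : 0 ≤ β) :
    Continuous fun x : ℝ => ∫ u in (0:ℝ)..1, (1 - u ^ β) * Real.cos (u * x) := by
  have hp : Continuous fun u : ℝ => u ^ β := Real.continuous_rpow_const hβ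
  apply intervalIntegral.continuous_parametric_intervalIntegral_of_continuous'
  have h2 : Continuous fun p : ℝ × ℝ => p.2 ^ β := hp.comp continuous_snd
  unfold Function.uncurry
  fun_prop

lemma intervalIntegrable_sub_one_mul_rpow {β : ℝ} (hβ : 1 ≤ β) (a b : ℝ) :
    IntervalIntegrable (fun u : ℝ => (β - 1) * u ^ (β - 2)) volume a b := by
  rcases hβ.eq_or_lt with rfl | h
  · simp
  · exact (intervalIntegral.intervalIntegrable_rpow' (by linarith)).const_mul _

lemma integral_sub_one_mul_rpow_le {β : ℝ} (hβ : 1 ≤ β) :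
    ∫ u in (0:ℝ)..1, (β - 1) * u ^ (β - 2) ≤ 1 := by
  rcases hβ.eq_or_lt with rfl | h
  · simp
  · rw [intervalIntegral.integral_const_mul, integral_rpow (Or.inl (by linarith)),
      Real.one_rpow, Real.zero_rpow (by linarith)]
    have : β - 2 + 1 = β - 1 := by ring
    rw [this, sub_zero, mul_one_div_cancel (by linarith)]

lemma abs_cosIntegral_le_one {β : ℝ} (hβ : 0 ≤ β) (x : ℝ) :
    |∫ u in (0:ℝ)..1, (1 - u ^ β) * Real.cos (u * x)| ≤ 1 := by
  have h := intervalIntegral.norm_integral_le_of_norm_le_const (a := 0) (b := 1) (C := 1)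
    (f := fun u : ℝ => (1 - u ^ β) * Real.cos (u * x)) (fun u hu => by
      rw [Set.uIoc_of_le zero_le_one] at hu
      rw [norm_mul, Real.norm_eq_abs, Real.norm_eq_abs]
      have h1 : u ^ β ≤ 1 := Real.rpow_le_one hu.1.le hu.2 hβ
      have h2 : 0 ≤ u ^ β := Real.rpow_nonneg hu.1.le _
      have h3 : |1 - u ^ β| ≤ 1 := by rw [abs_le]; constructor <;> linarith
      exact mul_le_one₀ h3 (abs_nonneg _) (Real.abs_cos_le_one _))
  simpa using h

lemma abs_sq_mul_cosIntegral_le {β : ℝ} (hβ : 1 ≤ β) (x : ℝ) :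
    |x ^ 2 * ∫ u in (0:ℝ)..1, (1 - u ^ β) * Real.cos (u * x)| ≤ 2 * β := by
  have hp : Continuous fun u : ℝ => u ^ β := Real.continuous_rpow_const (by linarith)
  have hp1 : Continuous fun u : ℝ => u ^ (β - 1) := Real.continuous_rpow_const (by linarith)
  have hi1 : IntervalIntegrable (fun u : ℝ => x ^ 2 * ((1 - u ^ β) * Real.cos (u * x)))
      volume 0 1 := by
    apply Continuous.intervalIntegrable
    fun_prop
  have hi2 : IntervalIntegrable
      (fun u : ℝ => (β - 1) * u ^ (β - 2) * (β * (1 - Real.cos (u * x)))) volume 0 1 :=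
    (intervalIntegrable_sub_one_mul_rpow hβ 0 1).mul_continuousOn (by fun_prop)
  have key := intervalIntegral.integral_eq_sub_of_hasDerivAt_of_le (a := 0) (b := 1) zero_le_one
    (f := fun u : ℝ => (1 - u ^ β) * (x * Real.sin (u * x)) +
      β * u ^ (β - 1) * (1 - Real.cos (u * x)))
    (f' := fun u : ℝ => x ^ 2 * ((1 - u ^ β) * Real.cos (u * x)) +
      (β - 1) * u ^ (β - 2) * (β * (1 - Real.cos (u * x))))
    (by fun_prop)
    (fun u hu => by
      have hx : HasDerivAt (fun u : ℝ => u * x) x u := hasDerivAt_mul_const x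
      have d1 := Real.hasDerivAt_rpow_const (x := u) (p := β) (Or.inl hu.1.ne')
      have d2 := Real.hasDerivAt_rpow_const (x := u) (p := β - 1) (Or.inl hu.1.ne')
      refine (((d1.const_sub 1).mul (hx.sin.const_mul x)).add
        ((d2.const_mul β).mul (hx.cos.const_sub 1))).congr_deriv ?_
      rw [show β - 1 - 1 = β - 2 by ring]
      ring)
    (hi1.add hi2)
  rw [intervalIntegral.integral_add hi1 hi2, intervalIntegral.integral_const_mul] at key
  have hnn : ∀ u ∈ Set.Icc (0:ℝ) 1, 0 ≤ (β - 1) * u ^ (β - 2) := fun u hu =>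
    mul_nonneg (by linarith) (Real.rpow_nonneg hu.1 _)
  have lower : 0 ≤ ∫ u in (0:ℝ)..1, (β - 1) * u ^ (β - 2) * (β * (1 - Real.cos (u * x))) :=
    intervalIntegral.integral_nonneg zero_le_one fun u hu =>
      mul_nonneg (hnn u hu)
        (mul_nonneg (by linarith) (by linarith [Real.cos_le_one (u * x)]))
  have upper : ∫ u in (0:ℝ)..1, (β - 1) * u ^ (β - 2) * (β * (1 - Real.cos (u * x))) ≤ 2 * β := by
    calc _ ≤ ∫ u in (0:ℝ)..1, (β - 1) * u ^ (β - 2) * (2 * β) :=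
          intervalIntegral.integral_mono_on zero_le_one hi2
            ((intervalIntegrable_sub_one_mul_rpow hβ 0 1).mul_const _) fun u hu =>
              mul_le_mul_of_nonneg_left
                (by nlinarith [Real.neg_one_le_cos (u * x)]) (hnn u hu)
      _ ≤ 1 * (2 * β) := by
          rw [intervalIntegral.integral_mul_const]
          exact mul_le_mul_of_nonneg_right (integral_sub_one_mul_rpow_le hβ) (by linarith)
      _ = 2 * β := one_mul _
  simp only [Real.one_rpow, sub_self, zero_mul, one_mul, mul_one, zero_add, Real.sin_zero,
    Real.cos_zero, mul_zero, add_zero, sub_zero] at key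
  rw [abs_le]
  have c1 := Real.cos_le_one x
  have c2 := Real.neg_one_le_cos x
  constructor <;> nlinarith

lemma integrable_cosIntegral {β : ℝ} (hβ : 1 ≤ β) :
    Integrable fun x : ℝ => ∫ u in (0:ℝ)..1, (1 - u ^ β) * Real.cos (u * x) := by
  refine (integrable_inv_one_add_sq.const_mul (1 + 2 * β)).mono'
    (continuous_cosIntegral (by linarith)).aestronglyMeasurable (ae_of_all _ fun x => ?_)
  have h1 := abs_cosIntegral_le_one (by linarith : 0 ≤ β) x
  have h2 := abs_sq_mul_cosIntegral_le hβ x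
  rw [abs_mul, abs_of_nonneg (sq_nonneg x)] at h2
  rw [Real.norm_eq_abs, ← div_eq_mul_inv, le_div_iff₀ (by positivity)]
  linarith

lemma continuous_truncatedPower {β : ℝ} (hβ : 0 ≤ β) :
    Continuous fun v : ℝ => ((max (1 - |v| ^ β) 0 : ℝ) : ℂ) := by
  have hp : Continuous fun v : ℝ => |v| ^ β :=
    (Real.continuous_rpow_const hβ).comp continuous_abs
  fun_prop

lemma truncatedPower_eq_zero {β : ℝ} (hβ : 0 ≤ β) {v : ℝ} (hv : 1 ≤ |v|) :
    max (1 - |v| ^ β) 0 = 0 :=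
  max_eq_right (by linarith [Real.one_le_rpow hv hβ])

lemma truncatedPower_of_mem_Icc {β : ℝ} (hβ : 0 ≤ β) {v : ℝ} (hv : v ∈ Set.Icc (0:ℝ) 1) :
    max (1 - |v| ^ β) 0 = 1 - v ^ β := by
  rw [abs_of_nonneg hv.1]
  exact max_eq_left (by linarith [Real.rpow_le_one hv.1 hv.2 hβ])

lemma integrable_truncatedPower {β : ℝ} (hβ : 0 ≤ β) :
    Integrable fun v : ℝ => ((max (1 - |v| ^ β) 0 : ℝ) : ℂ) := by
  refine (continuous_truncatedPower hβ).integrable_of_hasCompactSupport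
    (HasCompactSupport.intro (isCompact_Icc (a := (-1:ℝ)) (b := 1)) fun v hv => ?_)
  rw [truncatedPower_eq_zero hβ, Complex.ofReal_zero]
  by_contra! h
  exact hv (abs_le.1 h.le)

lemma fourier_truncatedPower {β : ℝ} (hβ : 0 ≤ β) (w : ℝ) :
    𝓕 (fun v : ℝ => ((max (1 - |v| ^ β) 0 : ℝ) : ℂ)) w =
      ((2 * ∫ u in (0:ℝ)..1, (1 - u ^ β) * Real.cos (u * (2 * Real.pi * w)) : ℝ) : ℂ) := by
  rw [Real.fourier_real_eq_integral_exp_smul]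
  set g : ℝ → ℂ := fun v => Complex.exp (↑(-2 * Real.pi * v * w) * Complex.I) •
    ((max (1 - |v| ^ β) 0 : ℝ) : ℂ) with hg
  have hgc : Continuous g := by
    have := continuous_truncatedPower hβ
    rw [hg]
    fun_prop
  have hsupp : Function.support g ⊆ Set.Ioc (-1) 1 := by
    intro v hv
    have : |v| < 1 := by
      by_contra! h
      exact hv (by simp only [hg]; rw [truncatedPower_eq_zero hβ h]; simp)
    exact ⟨(abs_lt.1 this).1, (abs_lt.1 this).2.le⟩
  rw [← intervalIntegral.integral_eq_integral_of_support_subset hsupp,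
    ← intervalIntegral.integral_add_adjacent_intervals (b := 0)
      (hgc.intervalIntegrable _ _) (hgc.intervalIntegrable _ _)]
  have hneg : ∫ v in (-1:ℝ)..0, g v = ∫ v in (0:ℝ)..1, g (-v) := by
    rw [intervalIntegral.integral_comp_neg, neg_zero]
  have hgn : Continuous fun v => g (-v) := hgc.comp continuous_neg
  rw [hneg, ← intervalIntegral.integral_add (hgn.intervalIntegrable _ _)
      (hgc.intervalIntegrable _ _),
    ← intervalIntegral.integral_const_mul, ← intervalIntegral.integral_ofReal]
  refine intervalIntegral.integral_congr fun v hv => ?_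
  rw [Set.uIcc_of_le zero_le_one] at hv
  simp only [hg, abs_neg, smul_eq_mul]
  rw [truncatedPower_of_mem_Icc hβ hv, ← add_mul]
  have hc := Complex.two_cos ((v * (2 * Real.pi * w) : ℝ) : ℂ)
  rw [Complex.ofReal_mul 2, Complex.ofReal_mul (1 - v ^ β), Complex.ofReal_cos, Complex.ofReal_ofNat,
    mul_left_comm, hc, mul_comm]
  congr 3 <;> push_cast <;> ring

lemma integral_cexp_mul_cosIntegral {β : ℝ} (hβ : 1 ≤ β) (l : ℝ) :
    (∫ x : ℝ, Complex.exp (Complex.I * l * x) *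
        (((1 / Real.pi) * ∫ u in (0:ℝ)..1, (1 - u ^ β) * Real.cos (u * x) : ℝ) : ℂ))
      = ((max (1 - |l| ^ β) 0 : ℝ) : ℂ) := by
  have hβ0 : 0 ≤ β := by linarith
  have hF := funext (fourier_truncatedPower hβ0)
  have hFi : Integrable (𝓕 (fun v : ℝ => ((max (1 - |v| ^ β) 0 : ℝ) : ℂ))) := by
    rw [hF]
    exact (((integrable_cosIntegral hβ).comp_mul_left' Real.two_pi_pos.ne').const_mul 2).ofReal
  have inv := congrFun ((continuous_truncatedPower hβ0).fourierInv_fourier_eq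
    (integrable_truncatedPower hβ0) hFi) l
  rw [hF, Real.fourierInv_eq'] at inv
  rw [← inv]
  have hs := Measure.integral_comp_mul_left (fun x : ℝ => Complex.exp (Complex.I * l * x) *
    (((1 / Real.pi) * ∫ u in (0:ℝ)..1, (1 - u ^ β) * Real.cos (u * x) : ℝ) : ℂ)) (2 * Real.pi)
  rw [abs_of_pos (inv_pos.2 Real.two_pi_pos), eq_inv_smul_iff₀ Real.two_pi_pos.ne'] at hs
  rw [← hs, ← integral_smul]
  congr 1 with v
  have hpi : (Real.pi : ℂ) ≠ 0 := Complex.ofReal_ne_zero.2 Real.pi_ne_zero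
  rw [show Complex.I * l * ((2 * Real.pi * v : ℝ) : ℂ)
      = ((2 * Real.pi * inner ℝ v l : ℝ) : ℂ) * Complex.I by
    simp only [RCLike.inner_apply, conj_trivial]; push_cast; ring]
  rw [Complex.real_smul, smul_eq_mul]
  generalize (∫ u in (0:ℝ)..1, (1 - u ^ β) * Real.cos (u * (2 * Real.pi * v))) = K
  push_cast
  field_simp

/-- The kernel `K_β(x) = (1/π) ∫_0^1 (1 - u^β) cos(ux) du` is integrable, has total
integral 1, and its Fourier transform is `λ ↦ max (1 - |λ|^β) 0`. -/
theorem stmt1 (β : ℝ) (hβ : 1 ≤ β) :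
    Integrable (fun x : ℝ => (1 / Real.pi) * ∫ u in (0:ℝ)..1, (1 - u ^ β) * Real.cos (u * x)) ∧
    (∫ x : ℝ, (1 / Real.pi) * ∫ u in (0:ℝ)..1, (1 - u ^ β) * Real.cos (u * x)) = 1 ∧
    ∀ l : ℝ,
      (∫ x : ℝ, Complex.exp (Complex.I * l * x) *
          (((1 / Real.pi) * ∫ u in (0:ℝ)..1, (1 - u ^ β) * Real.cos (u * x) : ℝ) : ℂ))
        = ((max (1 - |l| ^ β) 0 : ℝ) : ℂ) := by
  refine ⟨(integrable_cosIntegral hβ).const_mul _, ?_, integral_cexp_mul_cosIntegral hβ⟩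
  have h := integral_cexp_mul_cosIntegral hβ 0
  simp only [Complex.ofReal_zero, mul_zero, zero_mul, Complex.exp_zero, one_mul, abs_zero] at h
  rw [integral_complex_ofReal, Complex.ofReal_inj, Real.zero_rpow (by linarith)] at h
  simpa using h
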